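/- Let 0 ≤ e ≤ h−1, let C_i be an [n,k_i,d_i]_q linear code with 0 < k_i < n and Euclidean dual distance d_i^{⊥E} for i = 1,…,s, and let A be an s×s non-singular by columns (NSC) Toeplitz matrix over F_q. Let M_{τ'} be an n×n monomial matrix, D an s×s invertible diagonal matrix over F_q, σ' = (M_{τ'}, e), and σ = (M_τ, e) with M_τ = D ⊗ M_{τ'}. Then the matrix-product code [C_1,…,C_s]·(π_e(A)^{-1}·Q·D^{-1}) has length sn, dimension Σ_{i=1}^s k_i, and minimum distance at least min{(s+1−i)·d_i : 1 ≤ i ≤ s}; and C(A)^{⊥σ}, where C(A) = [C_1,…,C_s]·A, has length sn, dimension sn − Σ_{i=1}^s k_i, and minimum distance at least min{i·d_i^{⊥E} : 1 ≤ i ≤ s}. -/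

import Mathlib

open Matrix Finset Kronecker

variable {F : Type} [Field F] [DecidableEq F]

/-- Entrywise application of the map `π_e : x ↦ x ^ (p ^ e)` to a matrix. -/
def piE (p e : ℕ) {m n : Type} (A : Matrix m n F) : Matrix m n F :=
  A.map fun x => x ^ p ^ e

/-- Entrywise application of `π_e` to a vector. -/
def piEv (p e : ℕ) {n : Type} (v : n → F) : n → F := fun i => v i ^ p ^ e

/-- A monomial matrix: exactly one nonzero entry in each row and each column. -/
def IsMonomial {n : Type} [Fintype n] (M : Matrix n n F) : Prop :=
  (∀ i, ∃! j, M i j ≠ 0) ∧ (∀ j, ∃! i, M i j ≠ 0)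

/-- Non-singular by columns (NSC): for each `ℓ`, every `ℓ × ℓ` submatrix formed by the first
`ℓ` rows and any `ℓ` columns (in increasing order) is non-singular. -/
def IsNSC {s : ℕ} (A : Matrix (Fin s) (Fin s) F) : Prop :=
  ∀ (ℓ : ℕ) (hℓ : ℓ ≤ s) (j : Fin ℓ → Fin s), StrictMono j →
    (Matrix.of fun a b : Fin ℓ => A (Fin.castLE hℓ a) (j b)).det ≠ 0

/-- Toeplitz matrix: constant along diagonals. -/
def IsToeplitz {s : ℕ} (A : Matrix (Fin s) (Fin s) F) : Prop :=
  ∀ (i j : ℕ) (hi : i + 1 < s) (hj : j + 1 < s),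
    A ⟨i, Nat.lt_of_succ_lt hi⟩ ⟨j, Nat.lt_of_succ_lt hj⟩ = A ⟨i + 1, hi⟩ ⟨j + 1, hj⟩

/-- The anti-diagonal matrix `Q` with ones on the anti-diagonal. -/
def antiDiagQ (F : Type) [Field F] (s : ℕ) : Matrix (Fin s) (Fin s) F :=
  Matrix.of fun i j => if (i : ℕ) + (j : ℕ) + 1 = s then 1 else 0

/-- Dual of a code with respect to the pairing `⟨u, c⟩ = ∑ j, u j * g c j`. -/
def dualWith {n : Type} [Fintype n] (g : (n → F) → n → F) (C : Submodule F (n → F)) :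
    Submodule F (n → F) where
  carrier := {u | ∀ c ∈ C, ∑ j, u j * g c j = 0}
  add_mem' := by
    intro a b ha hb c hc
    simp only [Pi.add_apply, add_mul, Finset.sum_add_distrib, ha c hc, hb c hc, add_zero]
  zero_mem' := by
    intro c hc
    simp
  smul_mem' := by
    intro r a ha c hc
    simp only [Pi.smul_apply, smul_eq_mul, mul_assoc, ← Finset.mul_sum, ha c hc, mul_zero]

/-- The `σ = (M, e)` dual of a linear code. -/
def sigmaDual {n : Type} [Fintype n] (p e : ℕ) (M : Matrix n n F)
    (C : Submodule F (n → F)) : Submodule F (n → F) :=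
  dualWith (fun c => Matrix.vecMul (piEv p e c) M) C

/-- The Euclidean dual of a linear code. -/
def euclidDual {n : Type} [Fintype n] (C : Submodule F (n → F)) : Submodule F (n → F) :=
  dualWith id C

/-- The matrix-product code `[C_1, …, C_s] · A`, realized inside `Fin s × Fin n → F`
(block `j` of a codeword is `∑ i, A i j • c i`). -/
def matrixProductCode {n s : ℕ} (C : Fin s → Submodule F (Fin n → F))
    (A : Matrix (Fin s) (Fin s) F) : Submodule F (Fin s × Fin n → F) where
  carrier := {x | ∃ c : Fin s → Fin n → F, (∀ i, c i ∈ C i) ∧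
    ∀ jt : Fin s × Fin n, x jt = ∑ i, A i jt.1 * c i jt.2}
  add_mem' := by
    rintro x y ⟨c, hc, hx⟩ ⟨d, hd, hy⟩
    refine ⟨c + d, fun i => (C i).add_mem (hc i) (hd i), fun jt => ?_⟩
    simp [hx jt, hy jt, mul_add, Finset.sum_add_distrib]
  zero_mem' := ⟨0, fun i => (C i).zero_mem, fun jt => by simp⟩
  smul_mem' := by
    rintro r x ⟨c, hc, hx⟩
    refine ⟨r • c, fun i => (C i).smul_mem r (hc i), fun jt => ?_⟩
    simp [hx jt, Finset.mul_sum, mul_left_comm]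

/-- The minimum distance of the code `C` is at least `d`. -/
def minDistGe {n : Type} [Fintype n] (C : Submodule F (n → F)) (d : ℕ) : Prop :=
  ∀ x ∈ C, x ≠ 0 → d ≤ hammingNorm x

/-- The code `C` has minimum distance exactly `d`. -/
def minDistEq {n : Type} [Fintype n] (C : Submodule F (n → F)) (d : ℕ) : Prop :=
  minDistGe C d ∧ ∃ x ∈ C, x ≠ 0 ∧ hammingNorm x = d

/-- A nonzero vector whose image under an NSC matrix starts with `m` zeros has more than `m`
nonzero entries. -/
lemma IsNSC.lt_hammingNorm {s : ℕ} {A : Matrix (Fin s) (Fin s) F} (hA : IsNSC A)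
    {z : Fin s → F} (hz : z ≠ 0) {m : ℕ} (h : ∀ i : Fin s, (i : ℕ) < m → (A *ᵥ z) i = 0) :
    m < hammingNorm z := by
  by_contra! hle
  set S : Finset (Fin s) := univ.filter fun i => z i ≠ 0 with hS
  have hcard : S.card ≤ m := hle
  have hs : S.card ≤ s := by simpa using S.card_le_univ
  set j := S.orderEmbOfFin rfl with hj
  have hdet := hA S.card hs j j.strictMono
  have hmem (i : Fin s) (hi : z i ≠ 0) : ∃ b, j b = i := by
    have : i ∈ Set.range j := by
      rw [hj, Finset.range_orderEmbOfFin]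
      simp [hS, hi]
    exact this
  have hzero : (fun b => z (j b)) = 0 := by
    refine Matrix.eq_zero_of_mulVec_eq_zero hdet ?_
    ext a
    rw [Pi.zero_apply, ← h (Fin.castLE hs a) (by simpa using a.2.trans_le hcard)]
    simp only [Matrix.mulVec, dotProduct, Matrix.of_apply]
    refine Fintype.sum_of_injective j j.injective _ _ (fun i hi => ?_) (fun _ => rfl)
    by_contra hne
    obtain ⟨b, hb⟩ := hmem i fun h0 => hne (by simp [h0])
    exact hi ⟨b, hb⟩
  refine hz (funext fun i => ?_)
  by_contra hi
  obtain ⟨b, rfl⟩ := hmem i hi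
  exact hi (congrFun hzero b)

lemma IsNSC.det_ne_zero {s : ℕ} {A : Matrix (Fin s) (Fin s) F} (hA : IsNSC A) : A.det ≠ 0 :=
  hA s le_rfl id strictMono_id

lemma IsNSC.map {s : ℕ} {A : Matrix (Fin s) (Fin s) F} (hA : IsNSC A) (f : F →+* F) :
    IsNSC (A.map f) := by
  intro ℓ hℓ j hj
  have h := (map_ne_zero f).mpr (hA ℓ hℓ j hj)
  rwa [RingHom.map_det] at h

lemma IsToeplitz.map {s : ℕ} {A : Matrix (Fin s) (Fin s) F} (hA : IsToeplitz A) (f : F →+* F) :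
    IsToeplitz (A.map f) :=
  fun i j hi hj => congrArg f (hA i j hi hj)

lemma IsToeplitz.apply_add {s : ℕ} {A : Matrix (Fin s) (Fin s) F} (hA : IsToeplitz A)
    (i j k : ℕ) (hi : i + k < s) (hj : j + k < s) :
    A ⟨i + k, hi⟩ ⟨j + k, hj⟩ = A ⟨i, by omega⟩ ⟨j, by omega⟩ := by
  induction k with
  | zero => rfl
  | succ k ih => rw [← ih (by omega) (by omega)]; exact (hA _ _ hi hj).symm

lemma IsToeplitz.apply_rev {s : ℕ} {A : Matrix (Fin s) (Fin s) F} (hA : IsToeplitz A)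
    (i j : Fin s) : A j.rev i.rev = A i j := by
  obtain ⟨i, hi⟩ := i
  obtain ⟨j, hj⟩ := j
  rcases le_total (i + j) (s - 1) with h | h
  · rw [← hA.apply_add i j (s - 1 - (i + j)) (by omega) (by omega)]
    congr 1 <;> ext <;> simp only [Fin.val_rev] <;> omega
  · have := hA.apply_add (s - 1 - j) (s - 1 - i) (i + j - (s - 1)) (by omega) (by omega)
    convert this.symm using 2 <;> ext <;> simp only [Fin.val_rev] <;> omega

lemma antiDiagQ_apply {s : ℕ} (i j : Fin s) :
    antiDiagQ F s i j = if j = i.rev then 1 else 0 := by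
  have : (i : ℕ) + j + 1 = s ↔ j = i.rev := by
    rw [Fin.ext_iff, Fin.val_rev]; omega
  simp [antiDiagQ, this]

lemma antiDiagQ_mul {s : ℕ} (A : Matrix (Fin s) (Fin s) F) (i j : Fin s) :
    (antiDiagQ F s * A) i j = A i.rev j := by
  simp [Matrix.mul_apply, antiDiagQ_apply]

lemma mul_antiDiagQ {s : ℕ} (A : Matrix (Fin s) (Fin s) F) (i j : Fin s) :
    (A * antiDiagQ F s) i j = A i j.rev := by
  have (x : Fin s) : j = x.rev ↔ x = j.rev := by
    rw [Fin.ext_iff, Fin.ext_iff, Fin.val_rev, Fin.val_rev]; omega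
  simp [Matrix.mul_apply, antiDiagQ_apply, this]

lemma IsToeplitz.antiDiagQ_mul_transpose {s : ℕ} {A : Matrix (Fin s) (Fin s) F}
    (hA : IsToeplitz A) : antiDiagQ F s * Aᵀ = A * antiDiagQ F s := by
  ext i j
  rw [antiDiagQ_mul, mul_antiDiagQ, Matrix.transpose_apply, ← hA.apply_rev, Fin.rev_rev]

lemma isUnit_det_antiDiagQ (s : ℕ) : IsUnit (antiDiagQ F s).det := by
  refine Matrix.isUnit_det_of_left_inverse (B := antiDiagQ F s) ?_
  ext i j
  simp [antiDiagQ_mul, antiDiagQ_apply, Matrix.one_apply, eq_comm]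

/-- A monomial matrix permutes the entries of a vector and scales them by units. -/
lemma IsMonomial.exists_perm {n : Type} [Fintype n] {M : Matrix n n F} (hM : IsMonomial M) :
    ∃ (f : Equiv.Perm n) (a : n → F), (∀ i, a i ≠ 0) ∧ ∀ v i, (M *ᵥ v) i = a i * v (f i) := by
  choose f hf hf' using hM.1
  have hinj : Function.Injective f := fun i i' h =>
    (hM.2 (f i)).unique (hf i) (by simpa only [h] using hf i')
  refine ⟨Equiv.ofBijective f (Finite.injective_iff_bijective.mp hinj), fun i => M i (f i), hf,
    fun v i => ?_⟩
  refine Finset.sum_eq_single (f i) (fun j _ hj => ?_) (by simp)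
  have : M i j = 0 := by
    by_contra h
    exact hj (hf' i j h)
  simp [this]

lemma IsMonomial.isUnit {n : Type} [Fintype n] [DecidableEq n] {M : Matrix n n F}
    (hM : IsMonomial M) : IsUnit M := by
  obtain ⟨f, a, ha, h⟩ := hM.exists_perm
  rw [← Matrix.mulVec_injective_iff_isUnit]
  intro v w hvw
  ext i
  have := congrFun hvw (f.symm i)
  simp only [h, f.apply_symm_apply] at this
  exact mul_left_cancel₀ (ha _) this

lemma IsMonomial.hammingNorm_mulVec {n : Type} [Fintype n] {M : Matrix n n F}
    (hM : IsMonomial M) (v : n → F) : hammingNorm (M *ᵥ v) = hammingNorm v := by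
  obtain ⟨f, a, ha, h⟩ := hM.exists_perm
  refine Finset.card_equiv f fun i => ?_
  simp [h, ha]

lemma hammingNorm_prod_left {m n : Type} [Fintype m] [Fintype n] (x : m × n → F) :
    hammingNorm x = ∑ j, hammingNorm fun t => x (j, t) := by
  simp only [hammingNorm, Finset.card_filter, Fintype.sum_prod_type]

lemma hammingNorm_prod_right {m n : Type} [Fintype m] [Fintype n] (x : m × n → F) :
    hammingNorm x = ∑ t, hammingNorm fun j => x (j, t) := by
  simp only [hammingNorm, Finset.card_filter, Fintype.sum_prod_type_right]

lemma mul_hammingNorm_le {m n : Type} [Fintype m] [Fintype n] (x : m × n → F) (y : n → F)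
    (a : ℕ) (h : ∀ t, y t ≠ 0 → a ≤ hammingNorm fun j => x (j, t)) :
    a * hammingNorm y ≤ hammingNorm x := by
  rw [hammingNorm_prod_right, hammingNorm, Finset.card_filter, Finset.mul_sum]
  refine Finset.sum_le_sum fun t _ => ?_
  split_ifs with ht
  · simpa using h t ht
  · simp

lemma finrank_matrixProductCode {n s : ℕ} (C : Fin s → Submodule F (Fin n → F))
    {B : Matrix (Fin s) (Fin s) F} (hB : B.det ≠ 0) :
    Module.finrank F (matrixProductCode C B) = ∑ i, Module.finrank F (C i) := by
  let Φ : (∀ i, C i) →ₗ[F] (Fin s × Fin n → F) :=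
    { toFun := fun c jt => ∑ i, B i jt.1 * (c i : Fin n → F) jt.2
      map_add' := fun c d => by ext; simp [mul_add, Finset.sum_add_distrib]
      map_smul' := fun r c => by ext; simp [Finset.mul_sum, mul_left_comm] }
  have hinj : Function.Injective Φ := by
    rw [← LinearMap.ker_eq_bot, LinearMap.ker_eq_bot']
    intro c hc
    ext i t
    have : (fun i => (c i : Fin n → F) t) = 0 := by
      refine Matrix.eq_zero_of_vecMul_eq_zero hB ?_
      ext j
      simpa [Φ, Matrix.vecMul, dotProduct, mul_comm] using congrFun hc (j, t)
    exact congrFun this i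
  have hrange : LinearMap.range Φ = matrixProductCode C B := by
    ext x
    constructor
    · rintro ⟨c, rfl⟩
      exact ⟨fun i => c i, fun i => (c i).2, fun _ => rfl⟩
    · rintro ⟨c, hc, hx⟩
      exact ⟨fun i => ⟨c i, hc i⟩, funext fun jt => (hx jt).symm⟩
  rw [← hrange, LinearMap.finrank_range_of_inj hinj, Module.finrank_pi_fintype]

lemma finrank_euclidDual {n : Type} [Fintype n] (C : Submodule F (n → F)) :
    Module.finrank F (euclidDual C) = Fintype.card n - Module.finrank F C := by
  classical
  let B : LinearMap.BilinForm F (n → F) := dotProductBilin F F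
  have hdual : euclidDual C = B.orthogonal C := by
    ext u
    simp only [LinearMap.BilinForm.mem_orthogonal_iff]
    exact forall₂_congr fun c _ => by
      simp [B, dotProduct, mul_comm]
  have hrefl : B.IsRefl := fun u v h => by
    simpa [B, dotProduct_comm] using h
  have hnd : B.Nondegenerate :=
    hrefl.nondegenerate_iff_separatingLeft.mpr fun u hu => dotProduct_eq_zero u hu
  rw [hdual, LinearMap.BilinForm.finrank_orthogonal hnd, Module.finrank_fintype_fun_eq_card]

lemma finrank_sigmaDual [Finite F] {n : Type} [Fintype n] [DecidableEq n] (p e : ℕ) [ExpChar F p]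
    {M : Matrix n n F} (hM : IsUnit M) (C : Submodule F (n → F)) :
    Module.finrank F (sigmaDual p e M C) = Fintype.card n - Module.finrank F C := by
  have := Fintype.ofFinite F
  let π : F ≃+* F := iterateFrobeniusEquiv F p e
  let g : (n → F) → n → F := fun c => piEv p e c ᵥ* M
  have hg : Function.Injective g := by
    refine (Matrix.vecMul_injective_iff_isUnit.mpr hM).comp fun v w h => ?_
    ext i
    exact π.injective (congrFun h i)
  let C' : Submodule F (n → F) :=
    { carrier := g '' C
      zero_mem' := ⟨0, C.zero_mem, by
        simp only [g]
        convert Matrix.zero_vecMul M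
        ext i
        exact map_zero π⟩
      add_mem' := by
        rintro _ _ ⟨a, ha, rfl⟩ ⟨b, hb, rfl⟩
        refine ⟨a + b, C.add_mem ha hb, ?_⟩
        simp only [g, ← Matrix.add_vecMul]
        congr 1
        ext i
        exact map_add π (a i) (b i)
      smul_mem' := by
        rintro r _ ⟨a, ha, rfl⟩
        refine ⟨π.symm r • a, C.smul_mem _ ha, ?_⟩
        simp only [g, ← Matrix.smul_vecMul]
        congr 1
        ext i
        exact (map_mul π (π.symm r) (a i)).trans (by rw [π.apply_symm_apply]; rfl) }
  have hdual : sigmaDual p e M C = euclidDual C' := by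
    ext u
    exact (Set.forall_mem_image (f := g) (s := C) (p := fun c => ∑ j, u j * c j = 0)).symm
  have hcard : Nat.card C' = Nat.card C := Nat.card_image_of_injective hg C
  have hrank : Module.finrank F C' = Module.finrank F C := by
    rw [Module.natCard_eq_pow_finrank (K := F) (V := C'),
      Module.natCard_eq_pow_finrank (K := F) (V := C)] at hcard
    exact Nat.pow_right_injective (Finite.one_lt_card (α := F)) hcard
  rw [hdual, finrank_euclidDual, hrank]

/-- Distance bound for the matrix-product code of an inverse Toeplitz matrix. -/
lemma minDistGe_matrixProductCode_toeplitz {n s : ℕ} (hs : (univ : Finset (Fin s)).Nonempty)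
    {C : Fin s → Submodule F (Fin n → F)} {d : Fin s → ℕ} (hd : ∀ i, minDistGe (C i) (d i))
    {A : Matrix (Fin s) (Fin s) F} (hA : IsNSC A) (hT : IsToeplitz A)
    {D : Fin s → F} (hD : ∀ i, D i ≠ 0) :
    minDistGe (matrixProductCode C (A⁻¹ * antiDiagQ F s * (Matrix.diagonal D)⁻¹))
      (univ.inf' hs fun i : Fin s => (s - (i : ℕ)) * d i) := by
  rintro x ⟨c, hc, hx⟩ hx0
  have hne : {i | c i ≠ 0}.Nonempty := by
    by_contra h
    refine hx0 (funext fun jt => ?_)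
    have h0 (i : Fin s) : c i = 0 := by
      by_contra hi
      exact h ⟨i, hi⟩
    simp [hx, h0]
  obtain ⟨i, hi : c i ≠ 0, hi'⟩ := (Set.toFinite {i | c i ≠ 0}).exists_maximal hne
  have hmax (j : Fin s) (hij : i < j) : c j = 0 := by
    by_contra hj
    exact hij.not_ge (hi' hj hij.le)
  refine (Finset.inf'_le _ (mem_univ i)).trans ?_
  refine (Nat.mul_le_mul_left _ (hd i _ (hc i) hi)).trans (mul_hammingNorm_le x (c i) _ ?_)
  intro t ht
  set v : Fin s → F := fun i => c i t with hv
  set z : Fin s → F := fun j => D j * x (j, t) with hzdef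
  have hinv : (Matrix.diagonal D)⁻¹ * Matrix.diagonal D = 1 :=
    Matrix.nonsing_inv_mul _ (by simp [Matrix.det_diagonal, Finset.prod_ne_zero_iff, hD])
  have hz : z = v ᵥ* (A⁻¹ * antiDiagQ F s) := by
    have h1 : z = (fun j => x (j, t)) ᵥ* Matrix.diagonal D := by
      ext j
      simp [hzdef, Matrix.vecMul_diagonal, mul_comm]
    have h2 : (fun j => x (j, t)) = v ᵥ* (A⁻¹ * antiDiagQ F s * (Matrix.diagonal D)⁻¹) := by
      ext j
      simp [hx, hv, Matrix.vecMul, dotProduct, mul_comm]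
    rw [h1, h2, Matrix.vecMul_vecMul, Matrix.mul_assoc, hinv, Matrix.mul_one]
  have hAz : A *ᵥ z = fun j => v j.rev := by
    rw [← Matrix.vecMul_transpose, hz, Matrix.vecMul_vecMul, Matrix.mul_assoc,
      hT.antiDiagQ_mul_transpose, ← Matrix.mul_assoc,
      Matrix.nonsing_inv_mul _ hA.det_ne_zero.isUnit, Matrix.one_mul]
    ext j
    have := mul_antiDiagQ (Matrix.of fun _ : Fin s => v) j j
    simpa [Matrix.mul_apply, Matrix.vecMul, dotProduct] using this
  have hz0 : z ≠ 0 := by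
    intro h
    have := congrFun hAz i.rev
    simp only [h, Matrix.mulVec_zero, Pi.zero_apply, Fin.rev_rev] at this
    exact ht this.symm
  have hlt := hA.lt_hammingNorm hz0 (m := s - 1 - i) fun j hj => by
    have : i < j.rev := by rw [Fin.lt_def, Fin.val_rev]; omega
    rw [hAz]
    simp [hv, hmax _ this]
  have hnorm : hammingNorm z = hammingNorm fun j => x (j, t) := by
    simp [hammingNorm, hzdef, hD]
  omega

/-- Distance bound for the `σ` dual of a matrix-product code. -/
lemma minDistGe_sigmaDual_matrixProductCode [Finite F] {n s : ℕ} (p e : ℕ) [ExpChar F p]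
    (hs : (univ : Finset (Fin s)).Nonempty)
    {C : Fin s → Submodule F (Fin n → F)} {d : Fin s → ℕ}
    (hd : ∀ i, minDistGe (euclidDual (C i)) (d i))
    {A : Matrix (Fin s) (Fin s) F} (hA : IsNSC (piE p e A))
    {M : Matrix (Fin n) (Fin n) F} (hM : IsMonomial M)
    {D : Fin s → F} (hD : ∀ i, D i ≠ 0) :
    minDistGe (sigmaDual p e (Matrix.diagonal D ⊗ₖ M) (matrixProductCode C A))
      (univ.inf' hs fun i : Fin s => ((i : ℕ) + 1) * d i) := by
  intro u hu hu0
  let π : F ≃+* F := iterateFrobeniusEquiv F p e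
  set w : Fin s × Fin n → F := fun jt => (M *ᵥ fun t => u (jt.1, t)) jt.2 with hw
  have hnorm : hammingNorm w = hammingNorm u := by
    rw [hammingNorm_prod_left, hammingNorm_prod_left]
    exact Finset.sum_congr rfl fun j _ =>
      hM.hammingNorm_mulVec fun t => u (j, t)
  set z : Fin n → Fin s → F := fun t j => D j * w (j, t) with hz
  have hznorm (t : Fin n) : hammingNorm (z t) = hammingNorm fun j => w (j, t) := by
    simp [hammingNorm, hz, hD]
  set y : Fin s → Fin n → F := fun i t => (piE p e A *ᵥ z t) i with hy
  have horth (i : Fin s) (c : Fin n → F) (hc : c ∈ C i) : ∑ t, y i t * c t ^ p ^ e = 0 := by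
    have hmem : (fun jt : Fin s × Fin n => A i jt.1 * c jt.2) ∈ matrixProductCode C A := by
      refine ⟨Pi.single i c, fun j => ?_, fun jt => ?_⟩
      · by_cases h : j = i
        · subst h; simpa using hc
        · simp [h]
      · rw [Finset.sum_eq_single i (fun j _ hj => by simp [hj]) (by simp)]
        simp
    have h := hu _ hmem
    rw [← h]
    simp only [hy, hz, hw, Matrix.mulVec, Matrix.vecMul, dotProduct, piE, piEv, Matrix.map_apply,
      Matrix.kroneckerMap_apply, Fintype.sum_prod_type, Finset.mul_sum, Finset.sum_mul]
    rw [Finset.sum_comm]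
    refine Finset.sum_congr rfl fun j _ => ?_
    rw [Finset.sum_comm]
    refine Finset.sum_congr rfl fun t _ => ?_
    rw [Finset.sum_comm]
    refine Finset.sum_congr rfl fun t' _ => ?_
    rw [Finset.sum_eq_single j (fun j' _ hj' => by simp [Matrix.diagonal_apply_ne _ hj'])
      (by simp), Matrix.diagonal_apply_eq]
    ring
  have hdist (i : Fin s) (hi : y i ≠ 0) : d i ≤ hammingNorm (y i) := by
    have h := hd i (fun t => π.symm (y i t)) (fun c hc => by
      apply π.injective
      simp only [map_sum, map_mul, π.apply_symm_apply, map_zero, id]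
      exact horth i c hc) (fun h => hi (funext fun t => by simpa using congrFun h t))
    simpa [hammingNorm] using h
  have hne : {i | y i ≠ 0}.Nonempty := by
    by_contra h
    have h0 (i : Fin s) : y i = 0 := by
      by_contra hi
      exact h ⟨i, hi⟩
    have hz0 (t : Fin n) : z t = 0 :=
      Matrix.eq_zero_of_mulVec_eq_zero hA.det_ne_zero (funext fun i => congrFun (h0 i) t)
    have hw0 : w = 0 := by
      ext ⟨j, t⟩
      simpa [hz, hD] using congrFun (hz0 t) j
    rw [hw0, hammingNorm_zero] at hnorm
    exact hu0 (hammingNorm_eq_zero.mp hnorm.symm)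
  obtain ⟨i, hi : y i ≠ 0, hi'⟩ := (Set.toFinite {i | y i ≠ 0}).exists_minimal hne
  have hmin (j : Fin s) (hij : j < i) : y j = 0 := by
    by_contra hj
    exact hij.not_ge (hi' hj hij.le)
  refine (Finset.inf'_le _ (mem_univ i)).trans ?_
  rw [← hnorm]
  refine (Nat.mul_le_mul_left _ (hdist i hi)).trans (mul_hammingNorm_le w (y i) _ ?_)
  intro t ht
  rw [← hznorm]
  refine hA.lt_hammingNorm (fun h => ht ?_) fun j hj => congrFun (hmin j hj) t
  simp [hy, h]

/-- Construction IV, part 3: for an NSC Toeplitz `A`, the code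
`[C_1, …, C_s]·(π_e(A)⁻¹·Q·D⁻¹)` is an `[sn, ∑ k_i, ≥ min (s+1-i)d_i]` code and
`C(A)^{⊥σ}` is an `[sn, sn - ∑ k_i, ≥ min i·d_i^{⊥E}]` code. -/
theorem stmt11 {p h : ℕ} (hp : p.Prime) (hh : 0 < h)
    {F : Type} [Field F] [Fintype F] [DecidableEq F] (hcard : Fintype.card F = p ^ h)
    (e : ℕ) (he : e < h)
    {n s : ℕ} (hs : 0 < s)
    (C : Fin s → Submodule F (Fin n → F)) (k d dE : Fin s → ℕ)
    (hk : ∀ i, Module.finrank F (C i) = k i)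
    (hk0 : ∀ i, 0 < k i) (hkn : ∀ i, k i < n)
    (hd : ∀ i, minDistEq (C i) (d i))
    (hdE : ∀ i, minDistEq (euclidDual (C i)) (dE i))
    (A : Matrix (Fin s) (Fin s) F) (hA : IsNSC A) (hT : IsToeplitz A)
    (Mτ' : Matrix (Fin n) (Fin n) F) (hMτ' : IsMonomial Mτ')
    (D : Fin s → F) (hD : ∀ i, D i ≠ 0) :
    Module.finrank F
      (matrixProductCode C ((piE p e A)⁻¹ * antiDiagQ F s * (Matrix.diagonal D)⁻¹)) =
        ∑ i, k i ∧
    minDistGe (matrixProductCode C ((piE p e A)⁻¹ * antiDiagQ F s * (Matrix.diagonal D)⁻¹))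
      (Finset.univ.inf' (Finset.univ_nonempty_iff.mpr ⟨⟨0, hs⟩⟩)
        fun i : Fin s => (s - (i : ℕ)) * d i) ∧
    Module.finrank F
      (sigmaDual p e (Matrix.diagonal D ⊗ₖ Mτ') (matrixProductCode C A)) =
        s * n - ∑ i, k i ∧
    minDistGe (sigmaDual p e (Matrix.diagonal D ⊗ₖ Mτ') (matrixProductCode C A))
      (Finset.univ.inf' (Finset.univ_nonempty_iff.mpr ⟨⟨0, hs⟩⟩)
        fun i : Fin s => ((i : ℕ) + 1) * dE i) := by
  have : Fact p.Prime := ⟨hp⟩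
  have : CharP F p := charP_of_card_eq_prime_pow hcard
  have hpi : piE p e A = A.map (iterateFrobenius F p e) := rfl
  have hA' : IsNSC (piE p e A) := hpi ▸ hA.map _
  have hT' : IsToeplitz (piE p e A) := hpi ▸ hT.map _
  have hDu : IsUnit (Matrix.diagonal D).det := by
    simp [Matrix.det_diagonal, Finset.prod_ne_zero_iff, hD]
  refine ⟨?_, minDistGe_matrixProductCode_toeplitz _ (fun i => (hd i).1) hA' hT' hD, ?_,
    minDistGe_sigmaDual_matrixProductCode p e _ (fun i => (hdE i).1) hA' hMτ' hD⟩
  · rw [finrank_matrixProductCode, Finset.sum_congr rfl fun i _ => hk i]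
    rw [Matrix.det_mul, Matrix.det_mul]
    exact mul_ne_zero (mul_ne_zero
      (Matrix.isUnit_nonsing_inv_det _ hA'.det_ne_zero.isUnit).ne_zero
      (isUnit_det_antiDiagQ s).ne_zero) (Matrix.isUnit_nonsing_inv_det _ hDu).ne_zero
  · rw [finrank_sigmaDual, finrank_matrixProductCode C hA.det_ne_zero,
      Finset.sum_congr rfl fun i _ => hk i, Fintype.card_prod, Fintype.card_fin, Fintype.card_fin]
    rw [Matrix.isUnit_iff_isUnit_det, Matrix.det_kronecker]
    exact (hDu.pow _).mul (((Matrix.isUnit_iff_isUnit_det _).mp hMτ'.isUnit).pow _)
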